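/- arXiv:1901.10269 — 2 statements merged into one kernel-verified Lean document; each statement's English description precedes it below -/
import Mathlib

section
/- (c_{M₂} can be nonpositive) Let x ≠ y and let γ = (γ₀, …, γₙ) ∈ Γ^{x,y} be a path with Elev₁(γ) = H₁(x,y). Let I_max = {0 ≤ i ≤ n : U(γ_i) = H₁(x,y)}, and define s(γ) = max{U(γ_i) : 0 ≤ i ≤ n, i ∉ I_max} if I_max has exactly one element, and s(γ) = H₁(x,y) otherwise. Then H₂(x,y) ≤ Elev₂(γ) ≤ s(γ). Consequently, if for every pair x ≠ y there exists such a minimizing path γ with s(γ) ≤ U(x) + U(y), then c_{M₂} ≤ 0. -/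
open Finset Filter MeasureTheory

noncomputable def gibbs {X : Type*} [Fintype X] (p U : X → ℝ) (T : ℝ) (x : X) : ℝ :=
  Real.exp (-U x / T) * p x / ∑ y, Real.exp (-U y / T) * p y

noncomputable def M1 {X : Type*} [Fintype X] [DecidableEq X] (Q : X → X → ℝ) (U : X → ℝ)
    (T : ℝ) (x y : X) : ℝ :=
  if x = y then -∑ z ∈ Finset.univ.erase x, Q x z * Real.exp (-(max (U z - U x) 0) / T)
  else Q x y * Real.exp (-(max (U y - U x) 0) / T)

noncomputable def M2 {X : Type*} [Fintype X] [DecidableEq X] (Q : X → X → ℝ) (U : X → ℝ)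
    (T : ℝ) (x y : X) : ℝ :=
  if x = y then -∑ z ∈ Finset.univ.erase x, Q x z * Real.exp (max (U x - U z) 0 / T)
  else Q x y * Real.exp (max (U x - U y) 0 / T)

def IsPath {X : Type*} (Q : X → X → ℝ) (x y : X) (n : ℕ) (γ : ℕ → X) : Prop :=
  1 ≤ n ∧ γ 0 = x ∧ γ n = y ∧ ∀ i, 1 ≤ i → i ≤ n → 0 < Q (γ (i - 1)) (γ i)

noncomputable def Elev1 {X : Type*} (U : X → ℝ) (n : ℕ) (γ : ℕ → X) : ℝ :=
  sSup {r | ∃ i ≤ n, r = U (γ i)}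

noncomputable def Elev2 {X : Type*} (U : X → ℝ) (n : ℕ) (γ : ℕ → X) : ℝ :=
  sSup {r | ∃ i, 1 ≤ i ∧ i ≤ n ∧ r = min (U (γ (i - 1))) (U (γ i))}

noncomputable def H1 {X : Type*} (Q : X → X → ℝ) (U : X → ℝ) (x y : X) : ℝ :=
  sInf {r | ∃ n γ, IsPath Q x y n γ ∧ r = Elev1 U n γ}

noncomputable def H2 {X : Type*} (Q : X → X → ℝ) (U : X → ℝ) (x y : X) : ℝ :=
  sInf {r | ∃ n γ, IsPath Q x y n γ ∧ r = Elev2 U n γ}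

noncomputable def cM1 {X : Type*} (Q : X → X → ℝ) (U : X → ℝ) : ℝ :=
  sSup {r | ∃ x y, x ≠ y ∧ r = H1 Q U x y - U x - U y}

noncomputable def cM2 {X : Type*} (Q : X → X → ℝ) (U : X → ℝ) : ℝ :=
  sSup {r | ∃ x y, x ≠ y ∧ r = H2 Q U x y - U x - U y}

open Classical in
noncomputable def sGamma {X : Type*} (U : X → ℝ) (n : ℕ) (γ : ℕ → X) (h : ℝ) : ℝ :=
  if ∃! i, i ≤ n ∧ U (γ i) = h
  then sSup {r | ∃ i ≤ n, U (γ i) ≠ h ∧ r = U (γ i)}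
  else h

theorem le_Elev1 {X : Type*} [Finite X] (U : X → ℝ) {n i : ℕ} (γ : ℕ → X) (hi : i ≤ n) :
    U (γ i) ≤ Elev1 U n γ :=
  le_csSup ((Set.finite_range U).bddAbove.mono (by rintro _ ⟨j, -, rfl⟩; exact ⟨_, rfl⟩))
    ⟨i, hi, rfl⟩

theorem min_le_Elev2 {X : Type*} [Finite X] (U : X → ℝ) {n i : ℕ} (γ : ℕ → X)
    (hi : 1 ≤ i) (hin : i ≤ n) : min (U (γ (i - 1))) (U (γ i)) ≤ Elev2 U n γ := by
  refine le_csSup ?_ ⟨i, hi, hin, rfl⟩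
  obtain ⟨b, hb⟩ := (Set.finite_range U).bddAbove
  refine ⟨b, ?_⟩
  rintro _ ⟨j, -, -, rfl⟩
  exact (min_le_right _ _).trans (hb ⟨_, rfl⟩)

theorem H2_le_Elev2 {X : Type*} [Finite X] {Q : X → X → ℝ} (U : X → ℝ) {x y : X} {n : ℕ}
    {γ : ℕ → X} (hγ : IsPath Q x y n γ) : H2 Q U x y ≤ Elev2 U n γ := by
  refine csInf_le ?_ ⟨n, γ, hγ, rfl⟩
  obtain ⟨b, hb⟩ := (Set.finite_range U).bddBelow
  refine ⟨b, ?_⟩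
  rintro _ ⟨m, γ', hγ', rfl⟩
  exact (le_min (hb ⟨_, rfl⟩) (hb ⟨_, rfl⟩)).trans (min_le_Elev2 U γ' le_rfl hγ'.1)

theorem Elev2_le_sGamma {X : Type*} [Finite X] (U : X → ℝ) {n : ℕ} (hn : 1 ≤ n) (γ : ℕ → X) :
    Elev2 U n γ ≤ sGamma U n γ (Elev1 U n γ) := by
  refine csSup_le ⟨_, 1, le_rfl, hn, rfl⟩ ?_
  rintro _ ⟨i, hi, hin, rfl⟩
  unfold sGamma
  split_ifs with hunique
  · have le_second : ∀ j ≤ n, U (γ j) ≠ Elev1 U n γ →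
        U (γ j) ≤ sSup {r | ∃ i ≤ n, U (γ i) ≠ Elev1 U n γ ∧ r = U (γ i)} := fun j hj hne =>
      le_csSup ((Set.finite_range U).bddAbove.mono (by rintro _ ⟨k, -, -, rfl⟩; exact ⟨_, rfl⟩))
        ⟨j, hj, hne, rfl⟩
    by_cases hmax : U (γ i) = Elev1 U n γ
    · refine (min_le_left _ _).trans (le_second (i - 1) (by omega) fun hmax' => ?_)
      have := hunique.unique ⟨hin, hmax⟩ ⟨by omega, hmax'⟩
      omega
    · exact (min_le_right _ _).trans (le_second i hin hmax)
  · exact (min_le_right _ _).trans (le_Elev1 U γ hin)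

theorem cM2_can_be_nonpositive
    {X : Type*} [Fintype X] [DecidableEq X] [Nontrivial X]
    (Q : X → X → ℝ) (U : X → ℝ)
    (hQnn : ∀ x y : X, x ≠ y → 0 ≤ Q x y)
    (hQdiag : ∀ x : X, Q x x = -∑ y ∈ Finset.univ.erase x, Q x y)
    (hirr : ∀ x y : X, x ≠ y → ∃ n γ, IsPath Q x y n γ)
    (x y : X) (hxy : x ≠ y) (n : ℕ) (γ : ℕ → X)
    (hγ : IsPath Q x y n γ) (hmin : Elev1 U n γ = H1 Q U x y) :
    (H2 Q U x y ≤ Elev2 U n γ ∧ Elev2 U n γ ≤ sGamma U n γ (H1 Q U x y)) ∧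
    ((∀ x' y' : X, x' ≠ y' → ∃ (m : ℕ) (γ' : ℕ → X), IsPath Q x' y' m γ' ∧
        Elev1 U m γ' = H1 Q U x' y' ∧ sGamma U m γ' (H1 Q U x' y') ≤ U x' + U y') →
      cM2 Q U ≤ 0) := by
  refine ⟨⟨H2_le_Elev2 U hγ, hmin ▸ Elev2_le_sGamma U hγ.1 γ⟩, fun h => ?_⟩
  refine Real.sSup_le ?_ le_rfl
  rintro _ ⟨x', y', hne, rfl⟩
  obtain ⟨m, γ', hγ', hmin', hs⟩ := h x' y' hne
  have hle := (H2_le_Elev2 U hγ').trans (Elev2_le_sGamma U hγ'.1 γ')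
  rw [hmin'] at hle
  linarith
end

section
/- (Characterization of negative c_{M₂}) Assume min_{x ∈ 𝒳} U(x) = 0 and that U is injective (U has no repeated values). Then c_{M₂} < 0 if and only if c_{M₁} = 0. -/
open Finset Filter MeasureTheory

/-- The transitive closure of a relation is realised by finite chains indexed by `ℕ`. -/
theorem transGen_iff_exists_chain {X : Type*} (R : X → X → Prop) (x y : X) :
    Relation.TransGen R x y ↔ ∃ (n : ℕ) (γ : ℕ → X), 1 ≤ n ∧ γ 0 = x ∧ γ n = y ∧
      ∀ i, 1 ≤ i → i ≤ n → R (γ (i - 1)) (γ i) := by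
  constructor
  · intro h
    induction h with
    | @single b h =>
      refine ⟨1, fun i => if i = 0 then x else b, le_rfl, by simp, by simp, fun i h1 h2 => ?_⟩
      obtain rfl : i = 1 := by omega
      simpa using h
    | @tail b c _ hbc ih =>
      obtain ⟨n, γ, hn, h0, hγn, hγ⟩ := ih
      refine ⟨n + 1, fun i => if i ≤ n then γ i else c, by omega, by simp [h0], by simp,
        fun i h1 h2 => ?_⟩
      rcases Nat.lt_or_ge n i with h | h
      · obtain rfl : i = n + 1 := by omega
        simpa [hγn] using hbc
      · have : i - 1 ≤ n := by omega
        simpa [h, this] using hγ i h1 h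
  · rintro ⟨n, γ, hn, rfl, rfl, hγ⟩
    have key : ∀ m, 1 ≤ m → m ≤ n → Relation.TransGen R (γ 0) (γ m) := by
      intro m hm
      induction m, hm using Nat.le_induction with
      | base => exact fun h => .single (hγ 1 le_rfl h)
      | succ m hm ih => exact fun h => (ih (by omega)).tail (hγ (m + 1) (by omega) h)
    exact key n hn le_rfl

theorem finite_elev1_set {X : Type*} (U : X → ℝ) (n : ℕ) (γ : ℕ → X) :
    {r | ∃ i ≤ n, r = U (γ i)}.Finite :=
  ((Set.finite_Iic n).image fun i => U (γ i)).subset <| by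
    rintro _ ⟨i, hi, rfl⟩
    exact ⟨i, hi, rfl⟩

theorem finite_elev2_set {X : Type*} (U : X → ℝ) (n : ℕ) (γ : ℕ → X) :
    {r | ∃ i, 1 ≤ i ∧ i ≤ n ∧ r = min (U (γ (i - 1))) (U (γ i))}.Finite :=
  ((Set.finite_Iic n).image fun i => min (U (γ (i - 1))) (U (γ i))).subset <| by
    rintro _ ⟨i, -, hi, rfl⟩
    exact ⟨i, hi, rfl⟩

theorem elev1_le_iff {X : Type*} (U : X → ℝ) (n : ℕ) (γ : ℕ → X) (r : ℝ) :
    Elev1 U n γ ≤ r ↔ ∀ i ≤ n, U (γ i) ≤ r := by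
  rw [Elev1, csSup_le_iff (finite_elev1_set U n γ).bddAbove ⟨_, 0, Nat.zero_le n, rfl⟩]
  constructor
  · exact fun h i hi => h _ ⟨i, hi, rfl⟩
  · rintro h _ ⟨i, hi, rfl⟩
    exact h i hi

theorem elev2_lt_iff {X : Type*} (U : X → ℝ) {n : ℕ} (hn : 1 ≤ n) (γ : ℕ → X) (r : ℝ) :
    Elev2 U n γ < r ↔ ∀ i, 1 ≤ i → i ≤ n → min (U (γ (i - 1))) (U (γ i)) < r := by
  rw [Elev2, Set.Finite.csSup_lt_iff (finite_elev2_set U n γ) ⟨_, 1, le_rfl, hn, rfl⟩]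
  constructor
  · exact fun h i h1 hi => h _ ⟨i, h1, hi, rfl⟩
  · rintro h _ ⟨i, h1, hi, rfl⟩
    exact h i h1 hi

theorem elev1_mem_range {X : Type*} (U : X → ℝ) (n : ℕ) (γ : ℕ → X) :
    Elev1 U n γ ∈ Set.range U := by
  obtain ⟨i, -, hi⟩ := Set.Nonempty.csSup_mem (s := {r | ∃ i ≤ n, r = U (γ i)})
    ⟨_, 0, Nat.zero_le n, rfl⟩ (finite_elev1_set U n γ)
  exact ⟨γ i, hi.symm⟩

theorem finite_H1_set {X : Type*} [Finite X] (Q : X → X → ℝ) (U : X → ℝ) (x y : X) :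
    {r | ∃ n γ, IsPath Q x y n γ ∧ r = Elev1 U n γ}.Finite :=
  (Set.finite_range U).subset <| by
    rintro _ ⟨n, γ, -, rfl⟩
    exact elev1_mem_range U n γ

theorem H1_le_iff {X : Type*} [Finite X] {Q : X → X → ℝ} (U : X → ℝ) {x y : X}
    (hxy : ∃ n γ, IsPath Q x y n γ) (r : ℝ) :
    H1 Q U x y ≤ r ↔ Relation.TransGen (fun a b => 0 < Q a b ∧ U a ≤ r ∧ U b ≤ r) x y := by
  rw [transGen_iff_exists_chain]
  constructor
  · intro h
    obtain ⟨n₀, γ₀, h₀⟩ := hxy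
    obtain ⟨n, γ, ⟨hn, h0, hγn, hγ⟩, hH⟩ := Set.Nonempty.csInf_mem
      (s := {r | ∃ n γ, IsPath Q x y n γ ∧ r = Elev1 U n γ})
      ⟨_, n₀, γ₀, h₀, rfl⟩ (finite_H1_set Q U x y)
    have hU := (elev1_le_iff U n γ r).1 (hH.symm.trans_le h)
    exact ⟨n, γ, hn, h0, hγn, fun i h1 hi => ⟨hγ i h1 hi, hU _ (by omega), hU i hi⟩⟩
  · rintro ⟨n, γ, hn, h0, hγn, hγ⟩
    refine (csInf_le (finite_H1_set Q U x y).bddBelow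
      ⟨n, γ, ⟨hn, h0, hγn, fun i h1 hi => (hγ i h1 hi).1⟩, rfl⟩).trans
      ((elev1_le_iff U n γ r).2 fun i hi => ?_)
    rcases Nat.eq_zero_or_pos i with rfl | h1
    · exact (hγ 1 le_rfl hn).2.1
    · exact (hγ i h1 hi).2.2

theorem H2_lt_iff {X : Type*} {Q : X → X → ℝ} {U : X → ℝ} (hU : ∀ x, 0 ≤ U x) {x y : X}
    (hxy : ∃ n γ, IsPath Q x y n γ) (r : ℝ) :
    H2 Q U x y < r ↔ Relation.TransGen (fun a b => 0 < Q a b ∧ min (U a) (U b) < r) x y := by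
  have hbdd : BddBelow {r | ∃ n γ, IsPath Q x y n γ ∧ r = Elev2 U n γ} := by
    refine ⟨0, ?_⟩
    rintro _ ⟨n, γ, -, rfl⟩
    refine Real.sSup_nonneg ?_
    rintro _ ⟨i, -, -, rfl⟩
    exact le_min (hU _) (hU _)
  obtain ⟨n₀, γ₀, h₀⟩ := hxy
  rw [transGen_iff_exists_chain, H2, csInf_lt_iff hbdd ⟨_, n₀, γ₀, h₀, rfl⟩]
  constructor
  · rintro ⟨_, ⟨n, γ, ⟨hn, h0, hγn, hγ⟩, rfl⟩, h⟩
    exact ⟨n, γ, hn, h0, hγn,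
      fun i h1 hi => ⟨hγ i h1 hi, (elev2_lt_iff U hn γ r).1 h i h1 hi⟩⟩
  · rintro ⟨n, γ, hn, h0, hγn, hγ⟩
    exact ⟨_, ⟨n, γ, ⟨hn, h0, hγn, fun i h1 hi => (hγ i h1 hi).1⟩, rfl⟩,
      (elev2_lt_iff U hn γ r).2 fun i h1 hi => (hγ i h1 hi).2⟩

theorem finite_setOf_offDiag {X : Type*} [Finite X] (f : X → X → ℝ) :
    {r | ∃ x y, x ≠ y ∧ r = f x y}.Finite :=
  (Set.finite_range fun p : X × X => f p.1 p.2).subset <| by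
    rintro _ ⟨x, y, -, rfl⟩
    exact ⟨(x, y), rfl⟩

theorem cM2_neg_iff {X : Type*} [Finite X] [Nontrivial X] (Q : X → X → ℝ) (U : X → ℝ) :
    cM2 Q U < 0 ↔ ∀ x y, x ≠ y → H2 Q U x y < U x + U y := by
  obtain ⟨a, b, hab⟩ := exists_pair_ne X
  rw [cM2, Set.Finite.csSup_lt_iff (finite_setOf_offDiag fun x y => H2 Q U x y - U x - U y)
    ⟨_, a, b, hab, rfl⟩]
  constructor
  · intro h x y hxy
    linarith [h _ ⟨x, y, hxy, rfl⟩]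
  · rintro h _ ⟨x, y, hxy, rfl⟩
    linarith [h x y hxy]

theorem cM1_eq_zero_iff {X : Type*} [Finite X] [Nontrivial X] {Q : X → X → ℝ} {U : X → ℝ}
    (hirr : ∀ x y : X, x ≠ y → ∃ n γ, IsPath Q x y n γ) (hUmin : ∃ x, U x = 0) :
    cM1 Q U = 0 ↔ ∀ x y, x ≠ y → H1 Q U x y ≤ U x + U y := by
  obtain ⟨x₀, hx₀⟩ := hUmin
  obtain ⟨y₀, hy₀⟩ := exists_ne x₀
  have hbdd := (finite_setOf_offDiag fun x y => H1 Q U x y - U x - U y).bddAbove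
  have hH : U y₀ ≤ H1 Q U x₀ y₀ := by
    obtain ⟨n₀, γ₀, h₀⟩ := hirr x₀ y₀ hy₀.symm
    refine le_csInf ⟨_, n₀, γ₀, h₀, rfl⟩ ?_
    rintro _ ⟨n, γ, ⟨-, -, rfl, -⟩, rfl⟩
    exact (elev1_le_iff U n γ _).1 le_rfl n le_rfl
  have hnonneg : 0 ≤ cM1 Q U :=
    le_csSup_of_le hbdd ⟨x₀, y₀, hy₀.symm, rfl⟩ (by linarith)
  rw [← hnonneg.ge_iff_eq', cM1, csSup_le_iff hbdd ⟨_, x₀, y₀, hy₀.symm, rfl⟩]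
  constructor
  · intro h x y hxy
    linarith [h _ ⟨x, y, hxy, rfl⟩]
  · rintro h _ ⟨x, y, hxy, rfl⟩
    linarith [h x y hxy]

/-- If every state other than `x₀` has a strictly lower predecessor, then every state is reached
from `x₀` without exceeding its own level and without level steps. -/
theorem reflTransGen_of_lower_predecessor {X : Type*} [Finite X] {E : X → X → Prop} {U : X → ℝ}
    {x₀ : X} (h : ∀ y, y ≠ x₀ → ∃ w, E w y ∧ U w < U y) {r : ℝ} (y : X) (hy : U y ≤ r) :
    Relation.ReflTransGen (fun a b => E a b ∧ U a ≤ r ∧ U b ≤ r ∧ U a ≠ U b) x₀ y := by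
  have : IsTrans X (InvImage (· < ·) U) := ⟨fun _ _ _ hab hbc => lt_trans hab hbc⟩
  have : Std.Irrefl (InvImage (· < ·) U) := ⟨fun a => lt_irrefl (U a)⟩
  induction y using (Finite.wellFounded_of_trans_of_irrefl (InvImage (· < ·) U)).induction with
  | _ y ih =>
    by_cases hyx : y = x₀
    · rw [hyx]
    · obtain ⟨w, hE, hw⟩ := h y hyx
      exact (ih w hw (hw.le.trans hy)).tail ⟨hE, hw.le.trans hy, hy, hw.ne⟩

/-- If every state other than `x₀` has a strictly lower predecessor and a strictly lower successor,
then any two distinct states are joined through `x₀` without exceeding any common bound `r` of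
their levels and without level steps. -/
theorem transGen_of_lower_neighbors {X : Type*} [Finite X] {E : X → X → Prop} {U : X → ℝ}
    {x₀ : X} (hpred : ∀ y, y ≠ x₀ → ∃ w, E w y ∧ U w < U y)
    (hsucc : ∀ y, y ≠ x₀ → ∃ w, E y w ∧ U w < U y) {x y : X} (hxy : x ≠ y) {r : ℝ}
    (hx : U x ≤ r) (hy : U y ≤ r) :
    Relation.TransGen (fun a b => E a b ∧ U a ≤ r ∧ U b ≤ r ∧ U a ≠ U b) x y := by
  have hdown := (reflTransGen_of_lower_predecessor (E := Function.swap E) hsucc x hx).swap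
  have hdown' : Relation.ReflTransGen
      (fun a b => E a b ∧ U a ≤ r ∧ U b ≤ r ∧ U a ≠ U b) x x₀ :=
    Relation.ReflTransGen.mono
      (fun a b hab => ⟨hab.1, hab.2.2.1, hab.2.1, hab.2.2.2.symm⟩) _ _ hdown
  exact (Relation.reflTransGen_iff_eq_or_transGen.1
    (hdown'.trans (reflTransGen_of_lower_predecessor hpred y hy))).resolve_left hxy.symm

theorem cM2_neg_iff_cM1_zero
    {X : Type*} [Fintype X] [DecidableEq X] [Nontrivial X]
    (Q : X → X → ℝ) (U : X → ℝ)
    (hQnn : ∀ x y : X, x ≠ y → 0 ≤ Q x y)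
    (hQdiag : ∀ x : X, Q x x = -∑ y ∈ Finset.univ.erase x, Q x y)
    (hirr : ∀ x y : X, x ≠ y → ∃ n γ, IsPath Q x y n γ)
    (hUnn : ∀ x, 0 ≤ U x) (hUmin : ∃ x, U x = 0)
    (hUinj : Function.Injective U) :
    cM2 Q U < 0 ↔ cM1 Q U = 0 := by
  have hloop : ∀ x, Q x x ≤ 0 := fun x => by
    rw [hQdiag x, neg_nonpos]
    exact Finset.sum_nonneg fun y hy => hQnn x y (Finset.ne_of_mem_erase hy).symm
  rw [cM1_eq_zero_iff hirr hUmin, cM2_neg_iff]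
  obtain ⟨x₀, hx₀⟩ := hUmin
  have hlt : ∀ {a b}, a ≠ b → U a ≤ U b → U a < U b := fun hab h =>
    lt_of_le_of_ne h fun h' => hab (hUinj h')
  constructor
  · intro h x y hxy
    rw [H1_le_iff U (hirr x y hxy)]
    refine Relation.TransGen.mono (fun a b hab => ⟨hab.1, hab.2.1, hab.2.2.1⟩) _ _
      (transGen_of_lower_neighbors (E := fun a b => 0 < Q a b) (x₀ := x₀)
        (fun z hz => ?_) (fun z hz => ?_) hxy (le_add_of_nonneg_right (hUnn y))
        (le_add_of_nonneg_left (hUnn x)))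
    · have hH := h x₀ z hz.symm
      rw [hx₀, zero_add, H2_lt_iff hUnn (hirr x₀ z hz.symm)] at hH
      obtain ⟨w, -, hQ, hw⟩ := Relation.TransGen.tail'_iff.1 hH
      exact ⟨w, hQ, (min_lt_iff.1 hw).resolve_right (lt_irrefl _)⟩
    · have hH := h z x₀ hz
      rw [hx₀, add_zero, H2_lt_iff hUnn (hirr z x₀ hz)] at hH
      obtain ⟨w, ⟨hQ, hw⟩, -⟩ := Relation.TransGen.head'_iff.1 hH
      exact ⟨w, hQ, (min_lt_iff.1 hw).resolve_left (lt_irrefl _)⟩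
  · intro h x y hxy
    rw [H2_lt_iff hUnn (hirr x y hxy)]
    refine Relation.TransGen.mono ?_ _ _
      (transGen_of_lower_neighbors (E := fun a b => 0 < Q a b) (x₀ := x₀)
        (fun z hz => ?_) (fun z hz => ?_) hxy (le_add_of_nonneg_right (hUnn y))
        (le_add_of_nonneg_left (hUnn x)))
    · rintro a b ⟨hQ, ha, hb, hab⟩
      refine ⟨hQ, min_lt_iff.2 ?_⟩
      rcases lt_or_gt_of_ne hab with h' | h'
      · exact .inl (h'.trans_le hb)
      · exact .inr (h'.trans_le ha)
    · have hH := h x₀ z hz.symm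
      rw [hx₀, zero_add, H1_le_iff U (hirr x₀ z hz.symm)] at hH
      obtain ⟨w, -, hQ, hw, -⟩ := Relation.TransGen.tail'_iff.1 hH
      exact ⟨w, hQ, hlt (fun e => (hloop z).not_gt (e ▸ hQ)) hw⟩
    · have hH := h z x₀ hz
      rw [hx₀, add_zero, H1_le_iff U (hirr z x₀ hz)] at hH
      obtain ⟨w, ⟨hQ, -, hw⟩, -⟩ := Relation.TransGen.head'_iff.1 hH
      exact ⟨w, hQ, hlt (fun e => (hloop z).not_gt (e ▸ hQ)) hw⟩
end
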